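/- arXiv:2110.04638 — 2 statements merged into one kernel-verified Lean document; each statement's English description precedes it below -/
import Mathlib

section
/- Let G be a symmetric finite discounted stochastic game with N players and ε ≥ 0, and assume the set Δ^ε_eq of ε-equilibria of G is nonempty. Then for every joint policy γ_0 ∈ Δ there exists an ε-revision path consisting of at most N + 1 joint policies (i.e. γ_0, γ_1, …, γ_L with L ≤ N) whose final policy lies in Δ^ε_eq. -/
open scoped BigOperators

/-- A finite discounted stochastic game: finite player set `N`, finite state space `X`,
finite action sets `U i`, stage costs `c`, discount factors `β i ∈ [0,1)`, and a
transition kernel `P`. -/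
structure StochGame (N X : Type) (U : N → Type) [Fintype N] [DecidableEq N] [Fintype X]
    [∀ i, Fintype (U i)] : Type where
  c : N → X → (∀ j, U j) → ℝ
  β : N → ℝ
  β_nonneg : ∀ i, 0 ≤ β i
  β_lt_one : ∀ i, β i < 1
  P : X → (∀ j, U j) → X → ℝ
  P_nonneg : ∀ x a x', 0 ≤ P x a x'
  P_sum : ∀ x a, ∑ x', P x a x' = 1

/-- `γ` is a stationary policy: a stochastic kernel on actions given states. -/
def IsPol {X A : Type} [Fintype A] (γ : X → A → ℝ) : Prop :=
  (∀ x a, 0 ≤ γ x a) ∧ ∀ x, ∑ a, γ x a = 1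

section Game

variable {N X : Type} {U : N → Type} [Fintype N] [DecidableEq N] [Fintype X] [DecidableEq X]
  [∀ i, Fintype (U i)]

/-- A joint stationary policy: one stationary policy per player. -/
def IsJointPol (γ : ∀ i, X → U i → ℝ) : Prop := ∀ i, IsPol (γ i)

/-- Probability that joint action `a` is selected at state `x` (players randomize
independently). -/
def jointProb (γ : ∀ i, X → U i → ℝ) (x : X) (a : ∀ i, U i) : ℝ := ∏ i, γ i x (a i)

/-- Distribution of the state at time `t`, starting from `x0`, under joint policy `γ`. -/
noncomputable def stateDist (G : StochGame N X U) (γ : ∀ i, X → U i → ℝ) (x0 : X) :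
    ℕ → X → ℝ
  | 0, x => if x = x0 then 1 else 0
  | (t+1), x' => ∑ x, stateDist G γ x0 t x * ∑ a : ∀ i, U i, jointProb γ x a * G.P x a x'

/-- Expected stage cost of player `i` at time `t`, starting from `x0`, under `γ`. -/
noncomputable def expCost (G : StochGame N X U) (γ : ∀ i, X → U i → ℝ) (i : N) (x0 : X)
    (t : ℕ) : ℝ :=
  ∑ x, stateDist G γ x0 t x * ∑ a : ∀ j, U j, jointProb γ x a * G.c i x a

/-- `Jval G i x γ` is player `i`'s expected discounted cost from initial state `x`
under the joint stationary policy `γ`. -/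
noncomputable def Jval (G : StochGame N X U) (i : N) (x : X) (γ : ∀ j, X → U j → ℝ) : ℝ :=
  ∑' t : ℕ, (G.β i) ^ t * expCost G γ i x t

/-- `γ i` is an `ε`-best-response of player `i` to the policies `γ j`, `j ≠ i`, of the
remaining players. -/
def IsEpsBR (G : StochGame N X U) (ε : ℝ) (i : N) (γ : ∀ j, X → U j → ℝ) : Prop :=
  ∀ x, Jval G i x γ ≤
    (⨅ π : {f : X → U i → ℝ // IsPol f}, Jval G i x (Function.update γ i π.1)) + ε

/-- `γ` is an `ε`-equilibrium: every player is `ε`-best-responding. -/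
def IsEpsEq (G : StochGame N X U) (ε : ℝ) (γ : ∀ j, X → U j → ℝ) : Prop :=
  ∀ i, IsEpsBR G ε i γ

/-- `(path 0, …, path L)` is an `ε`-revision path: a player that is `ε`-best-responding
does not revise its policy at the next step. -/
def IsRevisionPath (G : StochGame N X U) (ε : ℝ) (L : ℕ)
    (path : ℕ → ∀ i, X → U i → ℝ) : Prop :=
  ∀ k < L, ∀ i, IsEpsBR G ε i (path k) → path (k+1) i = path k i

end Game

/-- A stochastic game with common action set `A` is symmetric: common discount factors,
and permuting the players' actions permutes the costs and leaves transitions unchanged. -/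
def IsSymmetricGame {N X A : Type} [Fintype N] [DecidableEq N] [Fintype X] [Fintype A]
    (G : StochGame N X (fun _ : N => A)) : Prop :=
  (∀ i j, G.β i = G.β j) ∧
  ∀ (σ : Equiv.Perm N) (i : N) (x : X) (a : N → A),
    G.c i x (fun j => a (σ j)) = G.c (σ i) x a ∧
    ∀ x', G.P x a x' = G.P x (fun j => a (σ j)) x'

theorem jointProb_comp_perm {N X A : Type} [Fintype N] (γ : ∀ _ : N, X → A → ℝ)
    (σ : Equiv.Perm N) (x : X) (a : N → A) :
    jointProb (U := fun _ : N => A) (fun k => γ (σ k)) x (fun k => a (σ k)) =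
      jointProb (U := fun _ : N => A) γ x a :=
  Equiv.prod_comp σ fun k => γ k x (a k)

/-- Expectations under a permuted joint policy are expectations of the permuted integrand. -/
theorem sum_jointProb_comp_perm {N X A : Type} [Fintype N] [DecidableEq N] [Fintype A]
    (γ : ∀ _ : N, X → A → ℝ) (σ : Equiv.Perm N) (x : X) (f : (N → A) → ℝ) :
    ∑ a : N → A, jointProb (U := fun _ : N => A) (fun k => γ (σ k)) x a * f a =
      ∑ a : N → A, jointProb (U := fun _ : N => A) γ x a * f fun k => a (σ k) := by
  rw [← Equiv.sum_comp (Equiv.arrowCongr σ.symm (Equiv.refl A))]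
  refine Finset.sum_congr rfl fun a _ => ?_
  exact congrArg (· * f fun k => a (σ k)) (jointProb_comp_perm γ σ x a)

section Symmetric

variable {N X A : Type} [Fintype N] [DecidableEq N] [Fintype X] [DecidableEq X] [Fintype A]
  {G : StochGame N X (fun _ : N => A)}

theorem IsSymmetricGame.stateDist_comp_perm (hG : IsSymmetricGame G) (i : N)
    (γ : ∀ _ : N, X → A → ℝ) (σ : Equiv.Perm N) (x0 : X) (t : ℕ) :
    stateDist G (fun k => γ (σ k)) x0 t = stateDist G γ x0 t := by
  induction t with
  | zero => rfl
  | succ t ih =>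
    funext x'
    simp only [stateDist, ih]
    refine Finset.sum_congr rfl fun x _ => ?_
    rw [sum_jointProb_comp_perm γ σ x fun a => G.P x a x']
    congr 1
    refine Finset.sum_congr rfl fun a _ => ?_
    rw [← (hG.2 σ i x a).2 x']

theorem IsSymmetricGame.Jval_comp_perm (hG : IsSymmetricGame G) (γ : ∀ _ : N, X → A → ℝ)
    (σ : Equiv.Perm N) (i : N) (x : X) :
    Jval G i x (fun k => γ (σ k)) = Jval G (σ i) x γ := by
  have hcost (t : ℕ) : expCost G (fun k => γ (σ k)) i x t = expCost G γ (σ i) x t := by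
    simp only [expCost, hG.stateDist_comp_perm i]
    refine Finset.sum_congr rfl fun y _ => ?_
    rw [sum_jointProb_comp_perm γ σ y fun a => G.c i y a]
    simp only [(hG.2 σ i y _).1]
  simp only [Jval, hcost, hG.1 i (σ i)]

/-- In a symmetric game, players using the same policy are `ε`-best-responding simultaneously. -/
theorem IsSymmetricGame.isEpsBR_of_eq (hG : IsSymmetricGame G) {ε : ℝ}
    {γ : ∀ _ : N, X → A → ℝ} {i j : N} (hij : γ i = γ j) (hi : IsEpsBR G ε i γ) :
    IsEpsBR G ε j γ := by
  have hswap : (fun k => γ (Equiv.swap i j k)) = γ := by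
    funext k
    rw [Equiv.swap_apply_def]
    split_ifs with h₁ h₂
    · rw [h₁, hij]
    · rw [h₂, hij]
    · rfl
  have hupdate (π : X → A → ℝ) :
      (fun k => Function.update γ j π (Equiv.swap i j k)) = Function.update γ i π := by
    funext k
    rw [Equiv.swap_apply_def]
    split_ifs with h₁ h₂
    · simp [h₁]
    · subst h₂
      rw [Function.update_of_ne (Ne.symm h₁), Function.update_of_ne h₁, hij]
    · rw [Function.update_of_ne h₁, Function.update_of_ne h₂]
  intro x
  have hJ (γ' : ∀ _ : N, X → A → ℝ) :
      Jval G j x γ' = Jval G i x (fun k => γ' (Equiv.swap i j k)) := by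
    rw [hG.Jval_comp_perm, Equiv.swap_apply_left]
  simp only [hJ, hswap, hupdate]
  exact hi x

end Symmetric

section Revision

variable {N X : Type} {U : N → Type} [Fintype N] [DecidableEq N] [Fintype X] [DecidableEq X]
  [∀ i, Fintype (U i)]

/-- Some `ε`-equilibrium is reached from `γ` by an `ε`-revision path with at most `n` steps. -/
def ReachesEpsEq (G : StochGame N X U) (ε : ℝ) (n : ℕ) (γ : ∀ i, X → U i → ℝ) : Prop :=
  ∃ (L : ℕ) (path : ℕ → ∀ i, X → U i → ℝ),
    L ≤ n ∧ path 0 = γ ∧ (∀ k ≤ L, IsJointPol (path k)) ∧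
    IsRevisionPath G ε L path ∧ IsEpsEq G ε (path L)

theorem IsEpsEq.reachesEpsEq {G : StochGame N X U} {ε : ℝ} {γ : ∀ i, X → U i → ℝ}
    (h : IsEpsEq G ε γ) (hγ : IsJointPol γ) (n : ℕ) : ReachesEpsEq G ε n γ :=
  ⟨0, fun _ => γ, n.zero_le, rfl, fun _ _ => hγ, fun _ hk => absurd hk (Nat.not_lt_zero _), h⟩

theorem ReachesEpsEq.cons {G : StochGame N X U} {ε : ℝ} {n : ℕ} {γ γ' : ∀ i, X → U i → ℝ}
    (h : ReachesEpsEq G ε n γ') (hγ : IsJointPol γ) (hstep : ∀ i, IsEpsBR G ε i γ → γ' i = γ i) :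
    ReachesEpsEq G ε (n + 1) γ := by
  obtain ⟨L, path, hL, h0, hpol, hrev, heq⟩ := h
  refine ⟨L + 1, fun k => Nat.casesOn k γ path, Nat.succ_le_succ hL, rfl, ?_, ?_, heq⟩
  · rintro (_ | k) hk
    · exact hγ
    · exact hpol k (Nat.le_of_succ_le_succ hk)
  · rintro (_ | k) hk i hi
    · exact (congrFun h0 i).trans (hstep i hi)
    · exact hrev k (Nat.lt_of_succ_lt_succ hk) i hi

end Revision

/-- In a symmetric game possessing an `ε`-equilibrium, the number of distinct policies in use
bounds the number of revision steps needed: as long as some, but not all, players are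
`ε`-best-responding, the others can adopt the policy of one who is, abandoning theirs. -/
theorem IsSymmetricGame.reachesEpsEq {N X A : Type} [Fintype N] [DecidableEq N] [Fintype X]
    [DecidableEq X] [Fintype A] {G : StochGame N X (fun _ : N => A)} (hG : IsSymmetricGame G)
    {ε : ℝ} (heq : ∃ γ : ∀ _ : N, X → A → ℝ, IsJointPol γ ∧ IsEpsEq G ε γ) (n : ℕ)
    (γ : ∀ _ : N, X → A → ℝ) (hγ : IsJointPol γ) (hn : (Set.range γ).ncard ≤ n) :
    ReachesEpsEq G ε n γ := by
  classical
  induction n generalizing γ with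
  | zero =>
    have hempty : Set.range γ = ∅ := (Set.ncard_eq_zero (Set.finite_range γ)).1 (by omega)
    have : IsEmpty N := Set.range_eq_empty_iff.1 hempty
    exact IsEpsEq.reachesEpsEq (fun i => isEmptyElim i) hγ 0
  | succ n ih =>
    by_cases hall : IsEpsEq G ε γ
    · exact hall.reachesEpsEq hγ _
    by_cases hnone : ∀ i, ¬ IsEpsBR G ε i γ
    · obtain ⟨γ', hγ', hγ'eq⟩ := heq
      exact (hγ'eq.reachesEpsEq hγ' n).cons hγ fun i hi => absurd hi (hnone i)
    obtain ⟨j, hj⟩ := not_forall.1 hall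
    obtain ⟨i, hi⟩ := not_forall_not.1 hnone
    let γ' : ∀ _ : N, X → A → ℝ := fun k => if IsEpsBR G ε k γ then γ k else γ i
    have hne (k : N) (hk : IsEpsBR G ε k γ) : γ k ≠ γ j := fun h => hj (hG.isEpsBR_of_eq h hk)
    have hγ' : IsJointPol (U := fun _ : N => A) γ' := by
      intro k
      by_cases hk : IsEpsBR G ε k γ
      · simpa [γ', hk] using hγ k
      · simpa [γ', hk] using hγ i
    have hsub : Set.range γ' ⊂ Set.range γ := by
      refine (Set.ssubset_iff_of_subset ?_).2 ⟨γ j, ⟨j, rfl⟩, ?_⟩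
      · rintro _ ⟨k, rfl⟩
        by_cases hk : IsEpsBR G ε k γ
        · exact ⟨k, by simp [γ', hk]⟩
        · exact ⟨i, by simp [γ', hk]⟩
      · rintro ⟨k, hk'⟩
        by_cases hk : IsEpsBR G ε k γ
        · exact hne k hk (by simpa [γ', hk] using hk')
        · exact hne i hi (by simpa [γ', hk] using hk')
    have hlt := Set.ncard_lt_ncard hsub (Set.finite_range γ)
    exact (ih γ' hγ' (by omega)).cons hγ fun k hk => if_pos hk

/-- in a symmetric game with a nonempty set of `ε`-equilibria, from any
joint policy there is an `ε`-revision path of at most `N + 1` joint policies (i.e. of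
length `L ≤ N`) ending at an `ε`-equilibrium. -/
theorem stmt2 {N X A : Type} [Fintype N] [DecidableEq N] [Fintype X] [DecidableEq X]
    [Fintype A]
    (G : StochGame N X (fun _ : N => A)) (hG : IsSymmetricGame G)
    (ε : ℝ) (hε : 0 ≤ ε)
    (heq : ∃ γ : ∀ _ : N, X → A → ℝ, IsJointPol γ ∧ IsEpsEq G ε γ)
    (γ0 : ∀ _ : N, X → A → ℝ) (hγ0 : IsJointPol γ0) :
    ∃ (L : ℕ) (path : ℕ → ∀ _ : N, X → A → ℝ),
      L ≤ Fintype.card N ∧ path 0 = γ0 ∧ (∀ k ≤ L, IsJointPol (path k)) ∧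
      IsRevisionPath G ε L path ∧ IsEpsEq G ε (path L) := by
  exact hG.reachesEpsEq heq _ γ0 hγ0 <| by
    simpa [Set.image_univ, Set.ncard_univ] using Set.ncard_image_le (f := γ0) Set.finite_univ
end

section
/- For every finite discounted stochastic game, every player i ∈ N and every ε > 0, there exists ξ > 0 with the following property: if Π^i ⊂ Δ^i is any finite set of policies such that every policy in Δ^i is within distance ξ of some element of Π^i, then for every joint policy γ^{-i} ∈ Δ^{-i} of the other players, the set Π^i contains an ε-best-response to γ^{-i}. -/
open scoped BigOperators

section StationaryPolicies

variable {N X : Type} {U : N → Type}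

lemma jointProb_nonneg [Fintype N] [∀ i, Fintype (U i)] {γ : ∀ i, X → U i → ℝ}
    (hγ : IsJointPol γ) (x : X) (a : ∀ i, U i) :
    0 ≤ jointProb γ x a :=
  Finset.prod_nonneg fun i _ => (hγ i).1 x (a i)

lemma sum_jointProb [Fintype N] [DecidableEq N] [∀ i, Fintype (U i)]
    {γ : ∀ i, X → U i → ℝ} (hγ : IsJointPol γ) (x : X) :
    ∑ a, jointProb γ x a = 1 := by
  simp only [jointProb, ← Fintype.prod_sum, (hγ _).2 x, Finset.prod_const_one]

lemma isCompact_setOf_isPol (A : Type) [Fintype A] : IsCompact {f : X → A → ℝ | IsPol f} := by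
  have h : {f : X → A → ℝ | IsPol f} = Set.univ.pi fun _ => stdSimplex ℝ A := by
    ext f
    simp [IsPol, stdSimplex, forall_and]
  rw [h]
  exact isCompact_univ_pi fun _ => isCompact_stdSimplex ℝ A

lemma isCompact_setOf_isJointPol [∀ i, Fintype (U i)] :
    IsCompact {γ : ∀ i, X → U i → ℝ | IsJointPol γ} := by
  have h : {γ : ∀ i, X → U i → ℝ | IsJointPol γ}
      = Set.univ.pi fun i => {f : X → U i → ℝ | IsPol f} := by
    ext γ
    simp [IsJointPol]
  rw [h]
  exact isCompact_univ_pi fun i => isCompact_setOf_isPol (U i)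

lemma IsJointPol.update [DecidableEq N] [∀ i, Fintype (U i)]
    {γ : ∀ i, X → U i → ℝ} (hγ : IsJointPol γ) {i : N} {f : X → U i → ℝ} (hf : IsPol f) : IsJointPol (Function.update γ i f) := by
  intro j
  rcases eq_or_ne j i with rfl | hj
  · simpa using hf
  · simpa [hj] using hγ j

lemma continuous_jointProb [Fintype N] (x : X) (a : ∀ i, U i) :
    Continuous fun γ : ∀ i, X → U i → ℝ => jointProb γ x a := by
  unfold jointProb
  fun_prop

variable [Fintype N] [DecidableEq N] [Fintype X] [∀ i, Fintype (U i)]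

/-- Transition matrix of the state process under the joint stationary policy `γ`. -/
noncomputable def transProb (G : StochGame N X U) (γ : ∀ i, X → U i → ℝ) (x x' : X) : ℝ :=
  ∑ a : ∀ i, U i, jointProb γ x a * G.P x a x'

/-- Expected stage cost of player `i` at state `x` under `γ`. -/
noncomputable def stageCost (G : StochGame N X U) (γ : ∀ i, X → U i → ℝ) (i : N) (x : X) : ℝ :=
  ∑ a : ∀ j, U j, jointProb γ x a * G.c i x a

/-- One-step cost operator of player `i` under `γ`, with continuation cost `V`. -/
noncomputable def bellmanOp (G : StochGame N X U) (i : N) (γ : ∀ j, X → U j → ℝ)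
    (V : X → ℝ) (x : X) : ℝ :=
  stageCost G γ i x + G.β i * ∑ y, transProb G γ x y * V y

lemma transProb_nonneg (G : StochGame N X U) {γ : ∀ i, X → U i → ℝ} (hγ : IsJointPol γ)
    (x y : X) : 0 ≤ transProb G γ x y :=
  Finset.sum_nonneg fun a _ => mul_nonneg (jointProb_nonneg hγ x a) (G.P_nonneg x a y)

lemma sum_transProb (G : StochGame N X U) {γ : ∀ i, X → U i → ℝ} (hγ : IsJointPol γ) (x : X) :
    ∑ y, transProb G γ x y = 1 := by
  simp only [transProb]
  rw [Finset.sum_comm]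
  simp only [← Finset.mul_sum, G.P_sum, mul_one, sum_jointProb hγ]

lemma abs_stageCost_le (G : StochGame N X U) {γ : ∀ i, X → U i → ℝ} (hγ : IsJointPol γ)
    (i : N) (x : X) : |stageCost G γ i x| ≤ ∑ y, ∑ a, |G.c i y a| := by
  have hprob : ∀ a, jointProb γ x a ≤ 1 := fun a =>
    sum_jointProb hγ x ▸
      Finset.single_le_sum (fun b _ => jointProb_nonneg hγ x b) (Finset.mem_univ a)
  calc |stageCost G γ i x| ≤ ∑ a, |jointProb γ x a * G.c i x a| :=
        Finset.abs_sum_le_sum_abs _ _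
    _ ≤ ∑ a, |G.c i x a| := by
        refine Finset.sum_le_sum fun a _ => ?_
        rw [abs_mul, abs_of_nonneg (jointProb_nonneg hγ x a)]
        exact mul_le_of_le_one_left (abs_nonneg _) (hprob a)
    _ ≤ _ := Finset.single_le_sum (f := fun y => ∑ a, |G.c i y a|)
        (fun y _ => Finset.sum_nonneg fun a _ => abs_nonneg _) (Finset.mem_univ x)

/-- A function dominated by its discounted one-step average is nonpositive. -/
lemma nonpos_of_le_discounted_average (G : StochGame N X U) {γ : ∀ i, X → U i → ℝ}
    (hγ : IsJointPol γ) (i : N) {W : X → ℝ}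
    (hW : ∀ x, W x ≤ G.β i * ∑ y, transProb G γ x y * W y) (x : X) : W x ≤ 0 := by
  have : Nonempty X := ⟨x⟩
  obtain ⟨m, hm⟩ := Finite.exists_max W
  have h : ∑ y, transProb G γ m y * W y ≤ W m := calc
    _ ≤ ∑ y, transProb G γ m y * W m :=
        Finset.sum_le_sum fun y _ => mul_le_mul_of_nonneg_left (hm y) (transProb_nonneg G hγ m y)
    _ = W m := by rw [← Finset.sum_mul, sum_transProb G hγ, one_mul]
  have h1 := (hW m).trans (mul_le_mul_of_nonneg_left h (G.β_nonneg i))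
  have h2 := G.β_lt_one i
  have h3 : W m ≤ 0 := by nlinarith
  exact (hm x).trans h3

/-- The one-step cost at `x` depends on the policies only through their values at `x`. -/
lemma bellmanOp_congr (G : StochGame N X U) (i : N) {γ δ : ∀ j, X → U j → ℝ} (V : X → ℝ)
    {x : X} (h : ∀ j, γ j x = δ j x) : bellmanOp G i γ V x = bellmanOp G i δ V x := by
  simp only [bellmanOp, stageCost, transProb, jointProb, h]

lemma summable_discount_bound (G : StochGame N X U) (i : N) (C : ℝ) :
    Summable fun t : ℕ => G.β i ^ t * C :=
  (summable_geometric_of_lt_one (G.β_nonneg i) (G.β_lt_one i)).mul_right C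

variable [DecidableEq X]

lemma expCost_eq (G : StochGame N X U) (γ : ∀ i, X → U i → ℝ) (i : N) (x : X) (t : ℕ) :
    expCost G γ i x t = ∑ y, stateDist G γ x t y * stageCost G γ i y := rfl

lemma stateDist_succ (G : StochGame N X U) (γ : ∀ i, X → U i → ℝ) (x z : X) (t : ℕ) :
    stateDist G γ x (t + 1) z = ∑ y, stateDist G γ x t y * transProb G γ y z := rfl

lemma stateDist_succ' (G : StochGame N X U) (γ : ∀ i, X → U i → ℝ) (x : X) (t : ℕ) :
    ∀ z, stateDist G γ x (t + 1) z = ∑ y, transProb G γ x y * stateDist G γ y t z := by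
  induction t with
  | zero => intro z; simp [stateDist, transProb]
  | succ t ih =>
    intro z
    rw [stateDist_succ]
    simp only [ih, stateDist_succ G γ _ z t, Finset.sum_mul, Finset.mul_sum]
    rw [Finset.sum_comm]
    simp only [mul_assoc]

lemma stateDist_nonneg (G : StochGame N X U) {γ : ∀ i, X → U i → ℝ} (hγ : IsJointPol γ)
    (x : X) (t : ℕ) : ∀ y, 0 ≤ stateDist G γ x t y := by
  induction t with
  | zero => intro y; simp only [stateDist]; split_ifs <;> norm_num
  | succ t ih =>
    intro y
    rw [stateDist_succ]
    exact Finset.sum_nonneg fun z _ => mul_nonneg (ih z) (transProb_nonneg G hγ z y)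

lemma sum_stateDist (G : StochGame N X U) {γ : ∀ i, X → U i → ℝ} (hγ : IsJointPol γ)
    (x : X) (t : ℕ) : ∑ y, stateDist G γ x t y = 1 := by
  induction t with
  | zero => simp [stateDist]
  | succ t ih =>
    simp only [stateDist_succ]
    rw [Finset.sum_comm]
    simp only [← Finset.mul_sum, sum_transProb G hγ, mul_one, ih]

lemma abs_expCost_le (G : StochGame N X U) {γ : ∀ i, X → U i → ℝ} (hγ : IsJointPol γ)
    (i : N) (x : X) (t : ℕ) : |expCost G γ i x t| ≤ ∑ y, ∑ a, |G.c i y a| := by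
  rw [expCost_eq]
  calc _ ≤ ∑ y, |stateDist G γ x t y * stageCost G γ i y| := Finset.abs_sum_le_sum_abs _ _
    _ ≤ ∑ y, stateDist G γ x t y * ∑ z, ∑ a, |G.c i z a| := by
        refine Finset.sum_le_sum fun y _ => ?_
        rw [abs_mul, abs_of_nonneg (stateDist_nonneg G hγ x t y)]
        exact mul_le_mul_of_nonneg_left (abs_stageCost_le G hγ i y) (stateDist_nonneg G hγ x t y)
    _ = _ := by rw [← Finset.sum_mul, sum_stateDist G hγ, one_mul]

lemma norm_discounted_expCost_le (G : StochGame N X U) {γ : ∀ i, X → U i → ℝ}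
    (hγ : IsJointPol γ) (i : N) (x : X) (t : ℕ) :
    ‖G.β i ^ t * expCost G γ i x t‖ ≤ G.β i ^ t * ∑ y, ∑ a, |G.c i y a| := by
  have h := pow_nonneg (G.β_nonneg i) t
  rw [Real.norm_eq_abs, abs_mul, abs_of_nonneg h]
  exact mul_le_mul_of_nonneg_left (abs_expCost_le G hγ i x t) h

lemma summable_discounted_expCost (G : StochGame N X U) {γ : ∀ i, X → U i → ℝ}
    (hγ : IsJointPol γ) (i : N) (x : X) : Summable fun t : ℕ => G.β i ^ t * expCost G γ i x t :=
  .of_norm_bounded (summable_discount_bound G i _) (norm_discounted_expCost_le G hγ i x)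

lemma expCost_succ (G : StochGame N X U) (γ : ∀ i, X → U i → ℝ) (i : N) (x : X) (t : ℕ) :
    expCost G γ i x (t + 1) = ∑ y, transProb G γ x y * expCost G γ i y t := by
  simp only [expCost_eq, stateDist_succ', Finset.sum_mul, Finset.mul_sum]
  rw [Finset.sum_comm]
  simp only [mul_assoc]

/-- The discounted cost is a fixed point of the one-step cost operator. -/
lemma Jval_eq_bellmanOp (G : StochGame N X U) {γ : ∀ i, X → U i → ℝ} (hγ : IsJointPol γ)
    (i : N) (x : X) : Jval G i x γ = bellmanOp G i γ (fun y => Jval G i y γ) x := by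
  have hs := summable_discounted_expCost G hγ i
  have h0 : expCost G γ i x 0 = stageCost G γ i x := by simp [expCost_eq, stateDist]
  rw [bellmanOp, Jval, (hs x).tsum_eq_zero_add, pow_zero, one_mul, h0]
  congr 1
  simp only [Jval, ← tsum_mul_left]
  rw [← Summable.tsum_finsetSum fun y _ => (hs y).mul_left _, ← tsum_mul_left]
  refine tsum_congr fun t => ?_
  rw [expCost_succ, Finset.mul_sum, Finset.mul_sum]
  exact Finset.sum_congr rfl fun y _ => by ring

lemma Jval_le_of_bellmanOp_le (G : StochGame N X U) {γ : ∀ i, X → U i → ℝ}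
    (hγ : IsJointPol γ) (i : N) {V : X → ℝ} (hV : ∀ x, bellmanOp G i γ V x ≤ V x) (x : X) :
    Jval G i x γ ≤ V x := by
  refine sub_nonpos.1 (nonpos_of_le_discounted_average G hγ i
    (W := fun y => Jval G i y γ - V y) (fun z => ?_) x)
  have h1 := Jval_eq_bellmanOp G hγ i z
  have h2 := hV z
  simp only [bellmanOp] at h1 h2
  simp only [mul_sub, Finset.sum_sub_distrib]
  linarith

lemma le_Jval_of_le_bellmanOp (G : StochGame N X U) {γ : ∀ i, X → U i → ℝ}
    (hγ : IsJointPol γ) (i : N) {V : X → ℝ} (hV : ∀ x, V x ≤ bellmanOp G i γ V x) (x : X) :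
    V x ≤ Jval G i x γ := by
  refine sub_nonpos.1 (nonpos_of_le_discounted_average G hγ i
    (W := fun y => V y - Jval G i y γ) (fun z => ?_) x)
  have h1 := Jval_eq_bellmanOp G hγ i z
  have h2 := hV z
  simp only [bellmanOp] at h1 h2
  simp only [mul_sub, Finset.sum_sub_distrib]
  linarith

lemma continuous_stateDist (G : StochGame N X U) (x : X) (t : ℕ) :
    ∀ y, Continuous fun γ : ∀ i, X → U i → ℝ => stateDist G γ x t y := by
  induction t with
  | zero => intro y; simp only [stateDist]; exact continuous_const
  | succ t ih =>
    intro y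
    simp only [stateDist]
    exact continuous_finsetSum _ fun z _ => (ih z).mul
      (continuous_finsetSum _ fun a _ => (continuous_jointProb z a).mul continuous_const)

lemma continuous_expCost (G : StochGame N X U) (i : N) (x : X) (t : ℕ) :
    Continuous fun γ : ∀ i, X → U i → ℝ => expCost G γ i x t := by
  unfold expCost
  exact continuous_finsetSum _ fun z _ => (continuous_stateDist G x t z).mul
    (continuous_finsetSum _ fun a _ => (continuous_jointProb z a).mul continuous_const)

lemma continuousOn_Jval (G : StochGame N X U) (i : N) (x : X) :
    ContinuousOn (Jval G i x) {γ | IsJointPol γ} :=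
  continuousOn_tsum (fun t => (continuous_const.mul (continuous_expCost G i x t)).continuousOn)
    (summable_discount_bound G i _) fun t _ hγ => norm_discounted_expCost_le G hγ i x t

/-- Against fixed policies of the other players, some stationary policy of player `i` is
optimal from every initial state simultaneously. -/
lemma exists_uniformly_optimal (G : StochGame N X U) (i : N) {γ : ∀ j, X → U j → ℝ}
    (hγ : IsJointPol γ) :
    ∃ f : X → U i → ℝ, IsPol f ∧ ∀ g : X → U i → ℝ, IsPol g → ∀ x,
      Jval G i x (Function.update γ i f) ≤ Jval G i x (Function.update γ i g) := by
  have hupd : Continuous fun f : X → U i → ℝ => Function.update γ i f :=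
    continuous_const.update i continuous_id
  have hcont : ContinuousOn (fun f : X → U i → ℝ => ∑ x, Jval G i x (Function.update γ i f))
      {f | IsPol f} :=
    continuousOn_finsetSum _ fun x _ => (continuousOn_Jval G i x).comp
      hupd.continuousOn fun f hf => hγ.update hf
  obtain ⟨f, hf, hmin⟩ := (isCompact_setOf_isPol (U i)).exists_isMinOn ⟨γ i, hγ i⟩ hcont
  refine ⟨f, hf, fun g hg => ?_⟩
  set V : X → ℝ := fun x => Jval G i x (Function.update γ i f) with hV
  have hVf : ∀ x, bellmanOp G i (Function.update γ i f) V x = V x := fun x =>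
    (Jval_eq_bellmanOp G (hγ.update hf) i x).symm
  refine le_Jval_of_le_bellmanOp G (hγ.update hg) i fun z => ?_
  by_contra! hz
  -- Switching from `f` to `g` at the single state `z` would improve the total cost.
  set h : X → U i → ℝ := Function.update f z (g z) with hh
  have hpol : IsPol h := by
    constructor <;> intro x <;> rcases eq_or_ne x z with rfl | hx
    · simpa [hh] using hg.1 x
    · simpa [hh, hx] using hf.1 x
    · simpa [hh] using hg.2 x
    · simpa [hh, hx] using hf.2 x
  have hop : bellmanOp G i (Function.update γ i h) V z
      = bellmanOp G i (Function.update γ i g) V z := by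
    refine bellmanOp_congr G i V fun j => ?_
    rcases eq_or_ne j i with rfl | hj
    · simp [hh]
    · simp [hj]
  have hle : ∀ x, bellmanOp G i (Function.update γ i h) V x ≤ V x := by
    intro x
    rcases eq_or_ne x z with rfl | hx
    · exact hop.trans_le hz.le
    · refine ((bellmanOp_congr G i V fun j => ?_).trans (hVf x)).le
      rcases eq_or_ne j i with rfl | hj
      · simp [hh, hx]
      · simp [hj]
  have hJle := Jval_le_of_bellmanOp_le G (hγ.update hpol) i hle
  have hJeq : ∀ x, Jval G i x (Function.update γ i h) = V x := fun x =>
    (Finset.sum_eq_sum_iff_of_le fun x _ => hJle x).1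
      (le_antisymm (Finset.sum_le_sum fun x _ => hJle x) (hmin hpol)) x (Finset.mem_univ x)
  have hfix := Jval_eq_bellmanOp G (hγ.update hpol) i z
  simp only [hJeq] at hfix
  exact (hfix.trans hop).not_gt hz

/-- The discounted cost is uniformly continuous in the joint policy, uniformly in the
initial state. -/
lemma exists_uniform_modulus (G : StochGame N X U) (i : N) {ε : ℝ} (hε : 0 < ε) :
    ∃ δ > 0, ∀ γ γ' : ∀ j, X → U j → ℝ, IsJointPol γ → IsJointPol γ' → dist γ γ' < δ →
      ∀ x, dist (Jval G i x γ) (Jval G i x γ') < ε := by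
  have huc := (isCompact_setOf_isJointPol (X := X) (U := U)).uniformContinuousOn_of_continuous
    (continuousOn_pi.2 fun x => continuousOn_Jval G i x)
  obtain ⟨δ, hδ, h⟩ := Metric.uniformContinuousOn_iff.1 huc ε hε
  exact ⟨δ, hδ, fun γ γ' hγ hγ' hd => (dist_pi_lt_iff hε).1 (h γ hγ γ' hγ' hd)⟩

end StationaryPolicies

/-- for every player `i` and `ε > 0` there is `ξ > 0` such that any
finite set `Π⁰` of policies for player `i` that covers `Δ^i` within distance `ξ`
contains an `ε`-best-response to every joint policy of the other players. -/
theorem stmt7 {N X : Type} {U : N → Type} [Fintype N] [DecidableEq N] [Fintype X]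
    [DecidableEq X] [∀ i, Fintype (U i)]
    (G : StochGame N X U) (i : N) (ε : ℝ) (hε : 0 < ε) :
    ∃ ξ > (0 : ℝ), ∀ Pi0 : Set (X → U i → ℝ), Pi0.Finite →
      (∀ f ∈ Pi0, IsPol f) →
      (∀ f : X → U i → ℝ, IsPol f → ∃ g ∈ Pi0, ∀ (s : X) (a : U i), |f s a - g s a| ≤ ξ) →
      ∀ γ : ∀ j, X → U j → ℝ, IsJointPol γ →
        ∃ g ∈ Pi0, IsEpsBR G ε i (Function.update γ i g) := by
  obtain ⟨δ, hδ, hmod⟩ := exists_uniform_modulus G i hε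
  refine ⟨δ / 2, half_pos hδ, fun Pi0 _ hpol hcover γ hγ => ?_⟩
  obtain ⟨f, hf, hopt⟩ := exists_uniformly_optimal G i hγ
  obtain ⟨g, hg, hfg⟩ := hcover f hf
  refine ⟨g, hg, fun x => ?_⟩
  have hdist : dist (Function.update γ i g) (Function.update γ i f) < δ := by
    refine lt_of_le_of_lt ((dist_pi_le_iff (half_pos hδ).le).2 fun j => ?_) (half_lt_self hδ)
    rcases eq_or_ne j i with rfl | hj
    · simp only [Function.update_self]
      refine (dist_pi_le_iff (half_pos hδ).le).2 fun s =>
        (dist_pi_le_iff (half_pos hδ).le).2 fun a => ?_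
      rw [dist_comm, Real.dist_eq]
      exact hfg s a
    · simpa [hj] using (half_pos hδ).le
  have hclose := hmod _ _ (hγ.update (hpol g hg)) (hγ.update hf) hdist x
  rw [Real.dist_eq] at hclose
  have : Nonempty {f : X → U i → ℝ // IsPol f} := ⟨⟨f, hf⟩⟩
  have hinf : Jval G i x (Function.update γ i f) ≤ ⨅ π : {f : X → U i → ℝ // IsPol f},
      Jval G i x (Function.update (Function.update γ i g) i π.1) :=
    le_ciInf fun π => by
      rw [Function.update_idem]
      exact hopt π.1 π.2 x
  linarith [(abs_lt.1 hclose).2]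
end
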